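/- (Cauchy invariance.) Let η : ℝ×ℝ³ → ℝ³ and q : ℝ×ℝ³ → ℝ be C², set v = ∂_tη, and assume that at every point (t,x) the Jacobian matrix ∇η (with entries ∂_μη^α) is invertible with inverse a, so that a^{μα}∂_μη^β = δ^{αβ} and a^{μβ}∂_νη^β = δ^{μν}. Assume the Lagrangian Euler equation ∂_tv^α + a^{μα}∂_μq = 0 holds at every point, and that η(0,x) = x for all x. Then for every (t,x) and every α ∈ {1,2,3}: ε^{αβγ} ∂_β v^μ(t,x) ∂_γ η_μ(t,x) = ε^{αβγ} ∂_β v_γ(0,x); that is, the quantity ε^{αβγ}∂_βv^μ∂_γη_μ is conserved in time and equals the α-th component of curl v(0,·). -/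

import Mathlib

open MeasureTheory

noncomputable section

/-- The Levi-Civita symbol `ε` on three indices (indices `0,1,2` stand for `1,2,3`). -/
def eps (i j k : Fin 3) : ℝ :=
  if (i, j, k) = ((0 : Fin 3), (1 : Fin 3), (2 : Fin 3)) ∨ (i, j, k) = (1, 2, 0) ∨
      (i, j, k) = (2, 0, 1) then 1
  else if (i, j, k) = ((0 : Fin 3), (2 : Fin 3), (1 : Fin 3)) ∨ (i, j, k) = (2, 1, 0) ∨
      (i, j, k) = (1, 0, 2) then -1
  else 0

/-- Time derivative `∂_t` of a scalar field on `ℝ × ℝ³`. -/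
def Dt (f : ℝ × (Fin 3 → ℝ) → ℝ) : ℝ × (Fin 3 → ℝ) → ℝ :=
  fun p => deriv (fun s => f (s, p.2)) p.1

/-- Spatial partial derivative `∂_μ` of a scalar field on `ℝ × ℝ³`
(`μ = 0,1,2` standing for `1,2,3`). -/
def Dx (μ : Fin 3) (f : ℝ × (Fin 3 → ℝ) → ℝ) : ℝ × (Fin 3 → ℝ) → ℝ :=
  fun p => fderiv ℝ (fun y => f (p.1, y)) p.2 (Pi.single μ 1)

/-- The cofactor matrix `a` of `∇η`: `a^{1α} = ε^{αλτ}∂₂η_λ∂₃η_τ`,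
`a^{2α} = −ε^{αλτ}∂₁η_λ∂₃η_τ`, `a^{3α} = ε^{αλτ}∂₁η_λ∂₂η_τ`. -/
def cof (η : ℝ × (Fin 3 → ℝ) → Fin 3 → ℝ) (μ α : Fin 3) : ℝ × (Fin 3 → ℝ) → ℝ :=
  fun p =>
    if μ = 0 then
      ∑ lam : Fin 3, ∑ τ : Fin 3,
        eps α lam τ * Dx 1 (fun r => η r lam) p * Dx 2 (fun r => η r τ) p
    else if μ = 1 then
      - ∑ lam : Fin 3, ∑ τ : Fin 3,
        eps α lam τ * Dx 0 (fun r => η r lam) p * Dx 2 (fun r => η r τ) p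
    else
      ∑ lam : Fin 3, ∑ τ : Fin 3,
        eps α lam τ * Dx 0 (fun r => η r lam) p * Dx 1 (fun r => η r τ) p

open Set Filter Topology in
/-- If `g = ∂_t f` with `f` and `g` both `C¹`, then the time derivative of a spatial directional
derivative of `f` exists and is the spatial derivative of `g`. -/
theorem hasDerivAt_fderiv_of_hasDerivAt_time {E : Type*} [NormedAddCommGroup E] [NormedSpace ℝ E]
    {f g : ℝ × E → ℝ} (hf : ContDiff ℝ 1 f) (hg : ContDiff ℝ 1 g)
    (h : ∀ t x, HasDerivAt (fun s => f (s, x)) (g (t, x)) t) (t : ℝ) (x e : E) :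
    HasDerivAt (fun s => fderiv ℝ f (s, x) (0, e)) (fderiv ℝ g (t, x) (0, e)) t := by
  have line : ∀ {k : ℝ × E → ℝ}, ContDiff ℝ 1 k → ∀ s r : ℝ,
      HasDerivAt (fun r : ℝ => k (s, x + r • e)) (fderiv ℝ k (s, x + r • e) (0, e)) r := by
    intro k hk s r
    have hline : HasDerivAt (fun r : ℝ => (s, x + r • e)) ((0 : ℝ), e) r := by
      have := ((hasDerivAt_id r).smul_const e).const_add x
      simpa using (hasDerivAt_const r s).prodMk this
    exact ((hk.differentiable one_ne_zero).differentiableAt.hasFDerivAt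
      (x := (s, x + r • e))).comp_hasDerivAt r hline
  have hg' : Continuous fun p : ℝ × ℝ => fderiv ℝ g (p.2, x + p.1 • e) (0, e) :=
    ((hg.continuous_fderiv one_ne_zero).comp (by fun_prop)).clm_apply continuous_const
  have hint : Continuous fun τ : ℝ => fderiv ℝ g (τ, x) (0, e) :=
    ((hg.continuous_fderiv one_ne_zero).comp (by fun_prop)).clm_apply continuous_const
  have hgc := hg.continuous
  have key : ∀ s : ℝ, fderiv ℝ f (s, x) (0, e) =
      fderiv ℝ f (0, x) (0, e) + ∫ τ in (0 : ℝ)..s, fderiv ℝ g (τ, x) (0, e) := by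
    intro s
    obtain ⟨C, hC⟩ := ((isCompact_closedBall (0 : ℝ) 1).prod
      (isCompact_uIcc (a := (0 : ℝ)) (b := s))).exists_bound_of_continuousOn hg'.continuousOn
    have hpar := (intervalIntegral.hasDerivAt_integral_of_dominated_loc_of_deriv_le
      (μ := volume) (a := 0) (b := s) (bound := fun _ => C)
      (F := fun r τ => g (τ, x + r • e))
      (F' := fun r τ => fderiv ℝ g (τ, x + r • e) (0, e))
      (Metric.closedBall_mem_nhds (0 : ℝ) one_pos)
      (Eventually.of_forall fun r => (Continuous.aestronglyMeasurable (by fun_prop)))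
      (Continuous.intervalIntegrable (by fun_prop) _ _)
      (hg'.comp (Continuous.prodMk_right (0 : ℝ))).aestronglyMeasurable
      (Eventually.of_forall fun τ hτ r hr => hC (r, τ) ⟨hr, uIoc_subset_uIcc hτ⟩)
      intervalIntegrable_const
      (Eventually.of_forall fun τ _ r _ => line hg τ r)).2
    have hftc : ∀ y, f (s, y) = f (0, y) + ∫ τ in (0 : ℝ)..s, g (τ, y) := fun y => by
      rw [intervalIntegral.integral_eq_sub_of_hasDerivAt (fun τ _ => h τ y)
        (Continuous.intervalIntegrable (by fun_prop) _ _)]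
      ring
    have h₁ := line hf s 0
    have h₂ := (line hf 0 0).add hpar
    have h₃ := h₁.unique (h₂.congr_of_eventuallyEq (Eventually.of_forall fun r => hftc _))
    simpa using h₃
  rw [funext key]
  exact (intervalIntegral.integral_hasDerivAt_right (hint.intervalIntegrable _ _)
    (hint.stronglyMeasurableAtFilter _ _) hint.continuousAt).const_add _

theorem Dx_eq_fderiv {f : ℝ × (Fin 3 → ℝ) → ℝ} {p : ℝ × (Fin 3 → ℝ)}
    (hf : DifferentiableAt ℝ f p) (μ : Fin 3) :
    Dx μ f p = fderiv ℝ f p (0, Pi.single μ 1) := by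
  have h : HasFDerivAt (fun y => f (p.1, y)) _ p.2 :=
    HasFDerivAt.comp (g := f) (f := fun y => (p.1, y)) p.2 hf.hasFDerivAt
      (hasFDerivAt_prodMk_right p.1 p.2)
  simp [Dx, h.fderiv]

theorem hasDerivAt_Dt {f : ℝ × (Fin 3 → ℝ) → ℝ} (hf : Differentiable ℝ f)
    (t : ℝ) (x : Fin 3 → ℝ) : HasDerivAt (fun s => f (s, x)) (Dt f (t, x)) t := by
  have h : DifferentiableAt ℝ (fun s => f (s, x)) t := by fun_prop
  exact h.hasDerivAt

theorem Dt_eq_fderiv {f : ℝ × (Fin 3 → ℝ) → ℝ} {p : ℝ × (Fin 3 → ℝ)}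
    (hf : DifferentiableAt ℝ f p) : Dt f p = fderiv ℝ f p (1, 0) := by
  have h : HasFDerivAt (fun s => f (s, p.2)) _ p.1 :=
    HasFDerivAt.comp (g := f) (f := fun s => (s, p.2)) p.1 hf.hasFDerivAt
      (hasFDerivAt_prodMk_left p.1 p.2)
  simp [Dt, h.hasDerivAt.deriv]

theorem contDiff_Dx {f : ℝ × (Fin 3 → ℝ) → ℝ} (hf : ContDiff ℝ 2 f) (μ : Fin 3) :
    ContDiff ℝ 1 (Dx μ f) := by
  have h : Dx μ f = fun p => fderiv ℝ f p (0, Pi.single μ 1) :=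
    funext fun p => Dx_eq_fderiv (hf.differentiable two_ne_zero p) μ
  rw [h]
  exact (hf.fderiv_right (m := 1) (by norm_num)).clm_apply contDiff_const

theorem contDiff_Dt {f : ℝ × (Fin 3 → ℝ) → ℝ} (hf : ContDiff ℝ 2 f) : ContDiff ℝ 1 (Dt f) := by
  have h : Dt f = fun p => fderiv ℝ f p (1, 0) :=
    funext fun p => Dt_eq_fderiv (hf.differentiable two_ne_zero p)
  rw [h]
  exact (hf.fderiv_right (m := 1) (by norm_num)).clm_apply contDiff_const

theorem Dx_comm {f : ℝ × (Fin 3 → ℝ) → ℝ} (hf : ContDiff ℝ 2 f) (μ ν : Fin 3)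
    (p : ℝ × (Fin 3 → ℝ)) : Dx μ (Dx ν f) p = Dx ν (Dx μ f) p := by
  have hf' : Differentiable ℝ (fderiv ℝ f) :=
    (hf.fderiv_right (m := 1) (by norm_num)).differentiable one_ne_zero
  have h : ∀ μ ν, Dx μ (Dx ν f) p =
      fderiv ℝ (fderiv ℝ f) p (0, Pi.single μ 1) (0, Pi.single ν 1) := by
    intro μ ν
    have hν : Dx ν f = fun p => fderiv ℝ f p (0, Pi.single ν 1) :=
      funext fun p => Dx_eq_fderiv (hf.differentiable two_ne_zero p) ν
    rw [Dx_eq_fderiv ((contDiff_Dx hf ν).differentiable one_ne_zero p), hν,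
      fderiv_clm_apply (hf' p) (differentiableAt_const _)]
    simp
  rw [h, h]
  exact hf.contDiffAt.isSymmSndFDerivAt (by simp) _ _

/-- Time and space derivatives commute for a `C¹` field whose time derivative is `C¹`. -/
theorem hasDerivAt_Dx {f : ℝ × (Fin 3 → ℝ) → ℝ} (hf : ContDiff ℝ 1 f) (hf' : ContDiff ℝ 1 (Dt f))
    (μ : Fin 3) (t : ℝ) (x : Fin 3 → ℝ) :
    HasDerivAt (fun s => Dx μ f (s, x)) (Dx μ (Dt f) (t, x)) t := by
  simp_rw [Dx_eq_fderiv (hf.differentiable one_ne_zero _),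
    Dx_eq_fderiv (hf'.differentiable one_ne_zero _)]
  exact hasDerivAt_fderiv_of_hasDerivAt_time hf hf'
    (hasDerivAt_Dt (hf.differentiable one_ne_zero)) t x _

theorem Dx_sum {ι : Type*} {s : Finset ι} {f : ι → ℝ × (Fin 3 → ℝ) → ℝ}
    (hf : ∀ i ∈ s, Differentiable ℝ (f i)) (μ : Fin 3) (p : ℝ × (Fin 3 → ℝ)) :
    Dx μ (fun r => ∑ i ∈ s, f i r) p = ∑ i ∈ s, Dx μ (f i) p := by
  have h : ∀ i ∈ s, DifferentiableAt ℝ (fun y => f i (p.1, y)) p.2 := fun i hi => by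
    have := hf i hi
    fun_prop
  simp [Dx, fderiv_fun_sum h]

theorem Dx_mul {f g : ℝ × (Fin 3 → ℝ) → ℝ} (hf : Differentiable ℝ f) (hg : Differentiable ℝ g)
    (μ : Fin 3) (p : ℝ × (Fin 3 → ℝ)) :
    Dx μ (fun r => f r * g r) p = Dx μ f p * g p + f p * Dx μ g p := by
  have h₁ : DifferentiableAt ℝ (fun y => f (p.1, y)) p.2 := by fun_prop
  have h₂ : DifferentiableAt ℝ (fun y => g (p.1, y)) p.2 := by fun_prop
  simp [Dx, fderiv_fun_mul h₁ h₂]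
  ring

theorem Dx_neg (f : ℝ × (Fin 3 → ℝ) → ℝ) (μ : Fin 3) (p : ℝ × (Fin 3 → ℝ)) :
    Dx μ (fun r => -f r) p = -Dx μ f p := by
  simp [Dx, fderiv_fun_neg]

theorem contDiff_matrix_det {ι E : Type*} [Fintype ι] [DecidableEq ι] [NormedAddCommGroup E]
    [NormedSpace ℝ E] {n : WithTop ℕ∞} {M : E → Matrix ι ι ℝ}
    (hM : ∀ i j, ContDiff ℝ n fun x => M x i j) : ContDiff ℝ n fun x => (M x).det := by
  simp_rw [Matrix.det_apply']
  exact ContDiff.sum fun σ _ => contDiff_const.mul (contDiff_prod fun i _ => hM _ _)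

/-- A pointwise left inverse of a `C^n` field of square matrices is `C^n`. -/
theorem contDiff_of_matrix_mul_eq_one {ι E : Type*} [Fintype ι] [DecidableEq ι]
    [NormedAddCommGroup E] [NormedSpace ℝ E] {n : WithTop ℕ∞} {A M : E → Matrix ι ι ℝ}
    (hM : ∀ i j, ContDiff ℝ n fun x => M x i j) (h : ∀ x, A x * M x = 1) (i j : ι) :
    ContDiff ℝ n fun x => A x i j := by
  have hA : (fun x => A x i j) = fun x => ((M x).det)⁻¹ * (M x).adjugate i j := by
    funext x
    rw [← Matrix.inv_eq_left_inv (h x), Matrix.inv_def, Ring.inverse_eq_inv']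
    rfl
  rw [hA]
  refine ((contDiff_matrix_det hM).inv fun x h0 => ?_).mul ?_
  · simpa [h0] using congrArg Matrix.det (h x)
  · simp_rw [Matrix.adjugate_apply]
    refine contDiff_matrix_det fun k l => ?_
    simp only [Matrix.updateRow_apply]
    split_ifs
    · exact contDiff_const
    · exact hM k l

theorem sum_eps_mul_eq_zero_of_symm {S : Fin 3 → Fin 3 → ℝ} (hS : ∀ β γ, S β γ = S γ β)
    (α : Fin 3) : ∑ β : Fin 3, ∑ γ : Fin 3, eps α β γ * S β γ = 0 := by
  fin_cases α <;> simp [eps, Fin.sum_univ_three, hS 1 0, hS 2 0, hS 2 1]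

/-- **Cauchy invariance:** for a solution of the free-boundary Euler equations in
Lagrangian coordinates, `ε^{αβγ} ∂_βv^μ ∂_γη_μ` is conserved in time and equals the
`α`-th component of `curl v(0,·)`. -/
theorem cauchy_invariance
    (η : ℝ × (Fin 3 → ℝ) → Fin 3 → ℝ) (q : ℝ × (Fin 3 → ℝ) → ℝ)
    (hη : ContDiff ℝ 2 η) (hq : ContDiff ℝ 2 q)
    (v : ℝ × (Fin 3 → ℝ) → Fin 3 → ℝ)
    (hv : ∀ (p : ℝ × (Fin 3 → ℝ)) (α : Fin 3), v p α = Dt (fun r => η r α) p)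
    (a : Fin 3 → Fin 3 → ℝ × (Fin 3 → ℝ) → ℝ)
    (hinv₁ : ∀ (p : ℝ × (Fin 3 → ℝ)) (α β : Fin 3),
      ∑ μ : Fin 3, a μ α p * Dx μ (fun r => η r β) p = if α = β then 1 else 0)
    (hinv₂ : ∀ (p : ℝ × (Fin 3 → ℝ)) (μ ν : Fin 3),
      ∑ β : Fin 3, a μ β p * Dx ν (fun r => η r β) p = if μ = ν then 1 else 0)
    (heuler : ∀ (p : ℝ × (Fin 3 → ℝ)) (α : Fin 3),
      Dt (fun r => v r α) p + ∑ μ : Fin 3, a μ α p * Dx μ q p = 0)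
    (hη0 : ∀ x : Fin 3 → ℝ, η (0, x) = x) :
    ∀ (t : ℝ) (x : Fin 3 → ℝ) (α : Fin 3),
      ∑ β : Fin 3, ∑ γ : Fin 3, ∑ μ : Fin 3,
          eps α β γ * Dx β (fun r => v r μ) (t, x) * Dx γ (fun r => η r μ) (t, x)
        = ∑ β : Fin 3, ∑ γ : Fin 3, eps α β γ * Dx β (fun r => v r γ) (0, x) := by
  intro t x α
  have hηc : ∀ μ, ContDiff ℝ 2 fun r => η r μ := contDiff_pi.mp hη
  have hvη : ∀ μ, (fun r => v r μ) = Dt fun r => η r μ := fun μ => funext fun p => hv p μ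
  have hvc : ∀ μ, ContDiff ℝ 1 fun r => v r μ := fun μ => hvη μ ▸ contDiff_Dt (hηc μ)
  have ha : ∀ μ β, ContDiff ℝ 1 (a μ β) := fun μ β =>
    contDiff_of_matrix_mul_eq_one (A := fun p => Matrix.of fun μ β => a μ β p)
      (M := fun p => Matrix.of fun β ν => Dx ν (fun r => η r β) p)
      (fun β ν => contDiff_Dx (hηc β) ν)
      (fun p => by ext μ ν; simpa [Matrix.mul_apply, Matrix.one_apply] using hinv₂ p μ ν) μ β
  have hDtv : ∀ β, Dt (fun r => v r β) = fun p => -∑ μ, a μ β p * Dx μ q p :=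
    fun β => funext fun p => eq_neg_of_add_eq_zero_left (heuler p β)
  have hDtvc : ∀ β, ContDiff ℝ 1 (Dt fun r => v r β) := fun β => by
    rw [hDtv]
    exact (ContDiff.sum fun μ _ => (ha μ β).mul (contDiff_Dx hq μ)).neg
  have hgrad : ∀ γ, (fun p => ∑ μ, Dt (fun r => v r μ) p * Dx γ (fun r => η r μ) p) =
      fun p => -Dx γ q p := fun γ => funext fun p => by
    calc ∑ μ, Dt (fun r => v r μ) p * Dx γ (fun r => η r μ) p
        = -∑ ν, (∑ β, a ν β p * Dx γ (fun r => η r β) p) * Dx ν q p := by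
          simp only [hDtv, Fin.sum_univ_three]
          ring
      _ = -Dx γ q p := by simp [hinv₂]
  have hgrad' : ∀ β γ p, ∑ μ, (Dx β (Dt fun r => v r μ) p * Dx γ (fun r => η r μ) p +
      Dt (fun r => v r μ) p * Dx β (Dx γ fun r => η r μ) p) = -Dx β (Dx γ q) p := by
    intro β γ p
    have hd := fun μ => (hDtvc μ).differentiable one_ne_zero
    have hd' := fun μ => (contDiff_Dx (hηc μ) γ).differentiable one_ne_zero
    have h := congrArg (fun F => Dx β F p) (hgrad γ)
    simp only [Dx_neg] at h
    rw [Dx_sum fun μ _ => (hd μ).fun_mul (hd' μ)] at h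
    rw [← h]
    exact Finset.sum_congr rfl fun μ _ => (Dx_mul (hd μ) (hd' μ) β p).symm
  have hsymm : ∀ p β γ,
      ∑ μ, (Dx β (Dt fun r => v r μ) p * Dx γ (fun r => η r μ) p +
        Dx β (fun r => v r μ) p * Dx γ (fun r => v r μ) p) =
      ∑ μ, (Dx γ (Dt fun r => v r μ) p * Dx β (fun r => η r μ) p +
        Dx γ (fun r => v r μ) p * Dx β (fun r => v r μ) p) := by
    intro p β γ
    have h := (hgrad' β γ p).trans
      ((congrArg Neg.neg (Dx_comm hq β γ p)).trans (hgrad' γ β p).symm)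
    simp only [fun μ => Dx_comm (hηc μ) β γ p] at h
    simp only [Finset.sum_add_distrib] at h ⊢
    simp only [add_left_injective _ h, mul_comm (Dx β (fun r => v r _) p)]
  have hderiv : ∀ s, HasDerivAt (fun s => ∑ β : Fin 3, ∑ γ : Fin 3, ∑ μ : Fin 3,
      eps α β γ * Dx β (fun r => v r μ) (s, x) * Dx γ (fun r => η r μ) (s, x)) 0 s := by
    intro s
    rw [← sum_eps_mul_eq_zero_of_symm (hsymm (s, x)) α]
    refine HasDerivAt.fun_sum fun β _ => HasDerivAt.fun_sum fun γ _ => ?_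
    rw [Finset.mul_sum]
    refine HasDerivAt.fun_sum fun μ _ => ?_
    have h₁ := hasDerivAt_Dx (hvc μ) (hDtvc μ) β s x
    have h₂ := hasDerivAt_Dx ((hηc μ).of_le one_le_two) (contDiff_Dt (hηc μ)) γ s x
    rw [← hvη] at h₂
    exact ((h₁.const_mul (eps α β γ)).mul h₂).congr_deriv (by ring)
  have hinit : ∀ γ μ, Dx γ (fun r => η r μ) (0, x) = if μ = γ then 1 else 0 := by
    intro γ μ
    simp only [Dx, hη0]
    rw [(hasFDerivAt_apply μ x).fderiv]
    simp [Pi.single_apply]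
  rw [is_const_of_deriv_eq_zero (fun s => (hderiv s).differentiableAt)
    (fun s => (hderiv s).deriv) t 0]
  simp [hinit]
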